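/- Let θ ∈ (0, π/10]. If q is an action minimizer of A over P(Q_S, Q_{E₁}) and q has a boundary collision (i.e. qᵢ(t₀) = qⱼ(t₀) for some i ≠ j and some t₀ ∈ {0,1}), then its action satisfies A(q) ≥ (3/8)·16^{1/3}·[ (2π²)^{1/3} + 2·(2θ)^{2/3} ]. -/

import Mathlib

open Real MeasureTheory Set
open scoped ENNReal

noncomputable section

/-- Euclidean norm on `ℝ × ℝ` (row vectors in the plane). -/
def enorm2 (v : ℝ × ℝ) : ℝ := Real.sqrt (v.1 ^ 2 + v.2 ^ 2)

/-- Row vector multiplied on the right by the rotation matrix `R θ`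
with rows `(cos θ, sin θ)` and `(-sin θ, cos θ)`. -/
def rotV (θ : ℝ) (v : ℝ × ℝ) : ℝ × ℝ :=
  (v.1 * Real.cos θ - v.2 * Real.sin θ, v.1 * Real.sin θ + v.2 * Real.cos θ)

/-- `H¹([0,1],(ℝ²)⁴)`: absolutely continuous paths `[0,1] → (ℝ²)⁴` with
square-integrable derivative, recorded via an integrable (a.e.-)derivative `v`
together with the integral representation of `q`. -/
structure H1Path4 where
  q : ℝ → Fin 4 → ℝ × ℝ
  v : ℝ → Fin 4 → ℝ × ℝ
  hvInt : ∀ i : Fin 4, IntegrableOn (fun t => v t i) (Icc (0:ℝ) 1)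
  hrep : ∀ i : Fin 4, ∀ t ∈ Icc (0:ℝ) 1, q t i = q 0 i + ∫ s in (0:ℝ)..t, v s i
  hL2 : ∀ i : Fin 4, IntegrableOn (fun t => enorm2 (v t i) ^ 2) (Icc (0:ℝ) 1)

/-- Center of mass at the origin throughout `[0,1]` (the path lies in `χ`). -/
def H1Path4.inChi (p : H1Path4) : Prop := ∀ t ∈ Icc (0:ℝ) 1, ∑ i, p.q t i = 0

/-- The Lagrangian action functional `A`, with value `+∞` allowed. -/
def action (p : H1Path4) : ℝ≥0∞ :=
  ∫⁻ t in Icc (0:ℝ) 1,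
    (ENNReal.ofReal ((1/2) * ∑ i, enorm2 (p.v t i) ^ 2)
      + ∑ i : Fin 4, ∑ j ∈ Finset.univ.filter (fun j => i < j),
          (ENNReal.ofReal (enorm2 (p.q t i - p.q t j)))⁻¹)

/-- The starting boundary configuration set `Q_S` (double isosceles with order
constraints). -/
def QSset : Set (Fin 4 → ℝ × ℝ) :=
  { c | ∃ a₁ b₁ c₁ : ℝ, 0 ≤ b₁ ∧ 0 ≤ c₁ ∧
      c = ![(-a₁ - c₁, 0), (-a₁, 0), ((2*a₁ + c₁)/2, b₁), ((2*a₁ + c₁)/2, -b₁)] }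

/-- The ending boundary configuration set `Q_{E₁}`. -/
def QE1set (θ : ℝ) : Set (Fin 4 → ℝ × ℝ) :=
  { c | ∃ a₂ b₂ c₂ : ℝ, 0 ≤ b₂ ∧ 0 ≤ c₂ ∧
      c = fun i => rotV θ (![(-b₂, -a₂), (-c₂, a₂), (c₂, a₂), (b₂, -a₂)] i) }

/-- The ending boundary configuration set `Q_{E₂}`. -/
def QE2set (θ : ℝ) : Set (Fin 4 → ℝ × ℝ) :=
  { c | ∃ a₂ b₂ c₂ : ℝ, 0 ≤ b₂ ∧ 0 ≤ c₂ ∧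
      c = fun i => rotV θ (![(-a₂, -b₂), (-a₂, b₂), (a₂, c₂), (a₂, -c₂)] i) }

/-- Membership in the admissible class `P(Q_S, E)`. -/
def inAdm (E : Set (Fin 4 → ℝ × ℝ)) (p : H1Path4) : Prop :=
  p.inChi ∧ p.q 0 ∈ QSset ∧ p.q 1 ∈ E

/-- `p` is an action minimizer over `P(Q_S, E)`. -/
def isMin (E : Set (Fin 4 → ℝ × ℝ)) (p : H1Path4) : Prop :=
  inAdm E p ∧ ∀ p' : H1Path4, inAdm E p' → action p ≤ action p'

/-- The Newtonian equations of the equal-mass four-body problem, on a set `s`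
of times. -/
def newton (Q : ℝ → Fin 4 → ℝ × ℝ) (s : Set ℝ) : Prop :=
  ∀ i : Fin 4, ∀ t ∈ s,
    deriv (deriv (fun u => Q u i)) t =
      ∑ j ∈ Finset.univ.erase i, (1 / enorm2 (Q t j - Q t i) ^ 3) • (Q t j - Q t i)

/-! ### Absolutely continuous functions -/

theorem AbsolutelyContinuousOnInterval.of_dist_le {f g k : ℝ → ℝ} {a b C : ℝ}
    (hf : AbsolutelyContinuousOnInterval f a b) (hg : AbsolutelyContinuousOnInterval g a b)
    (h : ∀ s ∈ uIcc a b, ∀ t ∈ uIcc a b,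
      dist (k s) (k t) ≤ C * (dist (f s) (f t) + dist (g s) (g t))) :
    AbsolutelyContinuousOnInterval k a b := by
  have hlim := (Filter.Tendsto.add hf hg).const_mul C
  rw [add_zero, mul_zero] at hlim
  refine squeeze_zero' (.of_forall fun E => Finset.sum_nonneg fun i _ => dist_nonneg) ?_ hlim
  refine Filter.eventually_inf_principal.2 (.of_forall fun E hE => ?_)
  rw [← Finset.sum_add_distrib, Finset.mul_sum]
  exact Finset.sum_le_sum fun i hi => h _ (hE.1 i hi).1 _ (hE.1 i hi).2

theorem AbsolutelyContinuousOnInterval.tan_comp {f : ℝ → ℝ} {a b c : ℝ}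
    (hf : AbsolutelyContinuousOnInterval f a b) (hc : c < π / 2)
    (h : ∀ t ∈ uIcc a b, f t ∈ Icc (-c) c) :
    AbsolutelyContinuousOnInterval (fun t => tan (f t)) a b := by
  have hcos : ∀ u ∈ Icc (-c) c, 0 < cos u := fun u hu =>
    cos_pos_of_mem_Ioo ⟨by linarith [hu.1], by linarith [hu.2]⟩
  have hC1 : ContDiffOn ℝ 1 tan (Icc (-c) c) := fun u hu =>
    (contDiffAt_tan.2 (hcos u hu).ne').contDiffWithinAt
  obtain ⟨K, hK⟩ := hC1.exists_lipschitzOnWith one_ne_zero (convex_Icc _ _) isCompact_Icc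
  refine hf.of_dist_le hf (C := K) fun s hs t ht => (hK.dist_le_mul _ (h s hs) _ (h t ht)).trans ?_
  gcongr
  linarith [dist_nonneg (x := f s) (y := f t)]

/-- `x` is a primitive on `[0,1]` of the integrable function `v`. -/
structure IsPrimitive (x v : ℝ → ℝ) : Prop where
  integrable : IntervalIntegrable v volume 0 1
  eq_add_integral : ∀ t ∈ Icc (0 : ℝ) 1, x t = x 0 + ∫ s in (0 : ℝ)..t, v s

namespace IsPrimitive

variable {x y v w : ℝ → ℝ}

theorem absolutelyContinuous (h : IsPrimitive x v) : AbsolutelyContinuousOnInterval x 0 1 := by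
  have hI := h.integrable.absolutelyContinuousOnInterval_intervalIntegral (c := 0) (by simp)
  refine hI.of_dist_le hI (C := 1) fun s hs t ht => ?_
  rw [uIcc_of_le zero_le_one] at hs ht
  rw [h.eq_add_integral s hs, h.eq_add_integral t ht, dist_add_left, one_mul]
  exact le_add_of_nonneg_right dist_nonneg

theorem continuousOn (h : IsPrimitive x v) : ContinuousOn x (Icc 0 1) := by
  simpa using h.absolutelyContinuous.continuousOn

theorem ae_hasDerivAt (h : IsPrimitive x v) :
    ∀ᵐ t, t ∈ Ioo (0 : ℝ) 1 → HasDerivAt x (v t) t := by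
  filter_upwards [h.integrable.ae_hasDerivAt_integral] with t ht htm
  have h1 := (ht (by rw [uIcc_of_le zero_le_one]; exact Ioo_subset_Icc_self htm) 0
    (by simp)).const_add (x 0)
  refine h1.congr_of_eventuallyEq ?_
  filter_upwards [Ioo_mem_nhds htm.1 htm.2] with u hu
  exact h.eq_add_integral u (Ioo_subset_Icc_self hu)

theorem linear_comb (h : IsPrimitive x v) (h' : IsPrimitive y w) (a b : ℝ) :
    IsPrimitive (fun t => a * x t + b * y t) (fun t => a * v t + b * w t) where
  integrable := (h.integrable.const_mul a).add (h'.integrable.const_mul b)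
  eq_add_integral t ht := by
    have hsub : uIcc 0 t ⊆ uIcc (0 : ℝ) 1 := by
      rw [uIcc_of_le ht.1, uIcc_of_le zero_le_one]; exact Icc_subset_Icc_right ht.2
    rw [intervalIntegral.integral_add ((h.integrable.mono_set hsub).const_mul a)
      ((h'.integrable.mono_set hsub).const_mul b), intervalIntegral.integral_const_mul,
      intervalIntegral.integral_const_mul, h.eq_add_integral t ht, h'.eq_add_integral t ht]
    ring

theorem of_integrable (hv : IntervalIntegrable v volume 0 1) (c : ℝ) :
    IsPrimitive (fun t => c + ∫ s in (0 : ℝ)..t, v s) v where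
  integrable := hv
  eq_add_integral t _ := by simp

end IsPrimitive

theorem dist_sqrt_sq_add_sq_le (a b c d : ℝ) :
    dist √(a ^ 2 + b ^ 2) √(c ^ 2 + d ^ 2) ≤ 1 * (dist a c + dist b d) := by
  have key : ∀ a b c d : ℝ, √(a ^ 2 + b ^ 2) ≤ √(c ^ 2 + d ^ 2) + (|a - c| + |b - d|) := by
    intro a b c d
    refine sqrt_le_iff.2 ⟨by positivity, ?_⟩
    have h1 : |c| ≤ √(c ^ 2 + d ^ 2) := abs_le_sqrt (by nlinarith [sq_nonneg d])
    have h2 : |d| ≤ √(c ^ 2 + d ^ 2) := abs_le_sqrt (by nlinarith [sq_nonneg c])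
    have h3 : √(c ^ 2 + d ^ 2) ^ 2 = c ^ 2 + d ^ 2 := sq_sqrt (by positivity)
    have h4 : c * (a - c) ≤ √(c ^ 2 + d ^ 2) * |a - c| := by
      calc c * (a - c) ≤ |c| * |a - c| := (le_abs_self _).trans (abs_mul _ _).le
        _ ≤ _ := by gcongr
    have h5 : d * (b - d) ≤ √(c ^ 2 + d ^ 2) * |b - d| := by
      calc d * (b - d) ≤ |d| * |b - d| := (le_abs_self _).trans (abs_mul _ _).le
        _ ≤ _ := by gcongr
    nlinarith [sq_abs (a - c), sq_abs (b - d), abs_nonneg (a - c), abs_nonneg (b - d),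
      mul_nonneg (abs_nonneg (a - c)) (abs_nonneg (b - d))]
  rw [one_mul, Real.dist_eq, Real.dist_eq, Real.dist_eq, abs_sub_le_iff]
  have h1 := key a b c d
  have h2 := key c d a b
  rw [abs_sub_comm c a, abs_sub_comm d b] at h2
  constructor <;> linarith

/-! ### The calibration -/

/-- The calibrating function. In Levi-Civita coordinates `z ^ 2 = r` with fictitious time `s`, it
is the Jacobi calibration of the quadratic functional `|z'| ^ 2 - ω ^ 2 |z| ^ 2`. Here `ρ` is the
distance to the origin and `x` the first coordinate of `r`. -/
def calibration (ω ε s ρ x : ℝ) : ℝ :=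
  -(ω * tan (ω * s) * (ρ + x)) + ω * tan (π / 2 - ε - ω * s) * (ρ - x)

theorem calibration_start (ω ε ρ : ℝ) : calibration ω ε 0 ρ ρ = 0 := by
  simp [calibration]

theorem calibration_nonneg {ω ε s ρ x φ : ℝ} (hω : 0 ≤ ω) (hs : 0 ≤ s) (hε : 0 < ε)
    (hφ : φ ≤ π) (h : ω * s + ε ≤ φ / 2) (hφ' : ω * s + ε < π / 2)
    (hρ : 0 ≤ ρ) (hx : x ≤ ρ * cos φ) (hxρ : -ρ ≤ x) : 0 ≤ calibration ω ε s ρ x := by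
  have hωs : 0 ≤ ω * s := mul_nonneg hω hs
  set γ := ω * s + ε with hγ
  have hγ0 : 0 < γ := by positivity
  have hcos : 0 < cos γ := cos_pos_of_mem_Ioo ⟨by linarith [pi_pos], hφ'⟩
  have hsin : 0 < sin γ := sin_pos_of_pos_of_lt_pi hγ0 (by linarith [pi_pos])
  have hx2 : x ≤ ρ * cos (2 * γ) := hx.trans <| mul_le_mul_of_nonneg_left
    (cos_le_cos_of_nonneg_of_le_pi (by linarith) hφ (by linarith)) hρ
  have hpy := sin_sq_add_cos_sq γ
  rw [cos_two_mul] at hx2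
  have htan : tan (ω * s) ≤ tan γ :=
    (strictMonoOn_tan.monotoneOn) ⟨by linarith [pi_pos], by linarith⟩
      ⟨by linarith [pi_pos], hφ'⟩ (by linarith)
  have h1 : tan (ω * s) * (ρ + x) ≤ 2 * ρ * (sin γ * cos γ) := by
    calc tan (ω * s) * (ρ + x) ≤ tan γ * (2 * ρ * cos γ ^ 2) := by
          gcongr
          · linarith
          · rw [tan_eq_sin_div_cos]; positivity
          · linarith
      _ = _ := by rw [tan_eq_sin_div_cos]; field_simp
  have h2 : 2 * ρ * (sin γ * cos γ) ≤ tan (π / 2 - ε - ω * s) * (ρ - x) := by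
    have : π / 2 - ε - ω * s = π / 2 - γ := by rw [hγ]; ring
    rw [this, tan_pi_div_two_sub, tan_eq_sin_div_cos, inv_div]
    calc 2 * ρ * (sin γ * cos γ) = cos γ / sin γ * (2 * ρ * sin γ ^ 2) := by field_simp
      _ ≤ _ := by gcongr; nlinarith
  have := mul_le_mul_of_nonneg_left (h1.trans h2) hω
  rw [calibration]
  linarith

/-- The pointwise form of the calibration inequality: `c`, `d` are the coordinates of the unit
vector `r / |r|`, and `P`, `Q` the two weights in the calibration. -/
theorem kinetic_ge_of_unit {c d P Q a b : ℝ} (h : c ^ 2 + d ^ 2 = 1) :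
    -(P ^ 2 * (1 + c)) - Q ^ 2 * (1 - c) - P * (c * a + d * b + a) + Q * (c * a + d * b - a) ≤
      1 / 2 * (a ^ 2 + b ^ 2) := by
  have hd : d ^ 2 = 1 - c ^ 2 := by linarith
  have key : 1 / 2 * (a + (P * (1 + c) + Q * (1 - c))) ^ 2 + 1 / 2 * (b + d * (P - Q)) ^ 2 =
      1 / 2 * (a ^ 2 + b ^ 2) + P ^ 2 * (1 + c) + Q ^ 2 * (1 - c)
        + P * (c * a + d * b + a) - Q * (c * a + d * b - a) := by
    linear_combination (1 / 2 * (P - Q) ^ 2) * hd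
  nlinarith [sq_nonneg (a + (P * (1 + c) + Q * (1 - c))), sq_nonneg (b + d * (P - Q))]

theorem hasDerivAt_sqrt_sq_add_sq {x y : ℝ → ℝ} {a b t : ℝ} (hx : HasDerivAt x a t)
    (hy : HasDerivAt y b t) (h0 : √(x t ^ 2 + y t ^ 2) ≠ 0) :
    HasDerivAt (fun u => √(x u ^ 2 + y u ^ 2))
      (x t / √(x t ^ 2 + y t ^ 2) * a + y t / √(x t ^ 2 + y t ^ 2) * b) t := by
  have h1 : x t ^ 2 + y t ^ 2 ≠ 0 := fun h => h0 (by rw [h, sqrt_zero])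
  convert! ((hx.pow 2).add (hy.pow 2)).sqrt h1 using 1
  simp only [Pi.add_apply, Pi.pow_apply]
  field_simp
  ring

/-- Along a planar path, with fictitious time `s` satisfying `ds/dt = τ / |r|`, `τ = ±1`, the
kinetic action minus `2 ω ^ 2` is bounded below by the increment of the calibration. -/
theorem calibration_increment_le {x y s vx vy : ℝ → ℝ} {τ ω ε : ℝ}
    (hx : IsPrimitive x vx) (hy : IsPrimitive y vy)
    (hs : IsPrimitive s (fun t => τ * (√(x t ^ 2 + y t ^ 2))⁻¹)) (hτ : τ ^ 2 = 1)
    (hne : ∀ᵐ t, t ∈ Ioo (0 : ℝ) 1 → √(x t ^ 2 + y t ^ 2) ≠ 0)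
    (hE : IntervalIntegrable (fun t => vx t ^ 2 + vy t ^ 2) volume 0 1) (hε : 0 < ε)
    (h0 : ∀ t ∈ Icc (0 : ℝ) 1, 0 ≤ ω * s t)
    (h1 : ∀ t ∈ Icc (0 : ℝ) 1, ω * s t + ε < π / 2) :
    τ * (calibration ω ε (s 1) √(x 1 ^ 2 + y 1 ^ 2) (x 1)
        - calibration ω ε (s 0) √(x 0 ^ 2 + y 0 ^ 2) (x 0)) ≤
      (1 / 2 * ∫ t in (0 : ℝ)..1, (vx t ^ 2 + vy t ^ 2)) - 2 * ω ^ 2 := by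
  have hI : uIcc (0 : ℝ) 1 = Icc 0 1 := uIcc_of_le zero_le_one
  have hsac := hs.absolutelyContinuous
  have hωs : AbsolutelyContinuousOnInterval (fun t => ω * s t) 0 1 := hsac.const_mul ω
  have hP : AbsolutelyContinuousOnInterval (fun t => tan (ω * s t)) 0 1 := by
    refine hωs.tan_comp (c := π / 2 - ε) (by linarith) fun t ht => ?_
    rw [hI] at ht
    exact ⟨by linarith [h0 t ht, h1 t ht], by linarith [h1 t ht]⟩
  have hQ : AbsolutelyContinuousOnInterval (fun t => tan (π / 2 - ε - ω * s t)) 0 1 := by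
    refine AbsolutelyContinuousOnInterval.tan_comp (c := π / 2 - ε) ?_ (by linarith)
      fun t ht => ?_
    · refine hωs.of_dist_le hωs (C := 1) fun u _ t _ => ?_
      rw [dist_sub_left, one_mul]
      exact le_add_of_nonneg_right dist_nonneg
    · rw [hI] at ht
      exact ⟨by linarith [h0 t ht, h1 t ht], by linarith [h0 t ht]⟩
  have hρ : AbsolutelyContinuousOnInterval (fun t => √(x t ^ 2 + y t ^ 2)) 0 1 :=
    hx.absolutelyContinuous.of_dist_le hy.absolutelyContinuous (C := 1)
      fun u _ t _ => dist_sqrt_sq_add_sq_le _ _ _ _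
  have hxac := hx.absolutelyContinuous
  have hH : AbsolutelyContinuousOnInterval
      (fun t => calibration ω ε (s t) √(x t ^ 2 + y t ^ 2) (x t)) 0 1 :=
    (((hP.const_mul ω).mul (hρ.add hxac)).neg).add ((hQ.const_mul ω).mul (hρ.sub hxac))
  have hint := hH.intervalIntegrable_deriv
  rw [← hH.integral_deriv_eq_sub, ← intervalIntegral.integral_const_mul]
  have hconst : 2 * ω ^ 2 = ∫ _ in (0 : ℝ)..1, 2 * ω ^ 2 := by simp
  rw [hconst, ← intervalIntegral.integral_const_mul, ← intervalIntegral.integral_sub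
    (hE.const_mul _) (by simp)]
  refine intervalIntegral.integral_mono_ae_restrict zero_le_one (hint.const_mul τ)
    ((hE.const_mul _).sub (by simp)) ?_
  rw [← restrict_Ioo_eq_restrict_Icc]
  refine (ae_restrict_iff' measurableSet_Ioo).2 ?_
  filter_upwards [hx.ae_hasDerivAt, hy.ae_hasDerivAt, hs.ae_hasDerivAt, hne]
    with t hxt hyt hst hnet ht
  specialize hxt ht
  specialize hyt ht
  specialize hst ht
  specialize hnet ht
  have ht' := Ioo_subset_Icc_self ht
  have hρt := hasDerivAt_sqrt_sq_add_sq hxt hyt hnet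
  have hcP : cos (ω * s t) ≠ 0 := (cos_pos_of_mem_Ioo
    ⟨by linarith [h0 t ht', pi_pos], by linarith [h1 t ht']⟩).ne'
  have hcQ : cos (π / 2 - ε - ω * s t) ≠ 0 := (cos_pos_of_mem_Ioo
    ⟨by linarith [h1 t ht', pi_pos], by linarith [h0 t ht']⟩).ne'
  have hωst := hst.const_mul ω
  have hPt := ((hasDerivAt_tan hcP).comp t hωst).const_mul ω
  have hQt := ((hasDerivAt_tan hcQ).comp t (hωst.const_sub (π / 2 - ε))).const_mul ω
  have hHt := ((hPt.mul (hρt.add hxt)).neg).add (hQt.mul (hρt.sub hxt))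
  have hd : deriv (fun t => calibration ω ε (s t) √(x t ^ 2 + y t ^ 2) (x t)) t = _ := hHt.deriv
  have hP2 : 1 / cos (ω * s t) ^ 2 = 1 + tan (ω * s t) ^ 2 := by
    rw [← inv_one_add_tan_sq hcP]; simp
  have hQ2 : 1 / cos (π / 2 - ε - ω * s t) ^ 2 = 1 + tan (π / 2 - ε - ω * s t) ^ 2 := by
    rw [← inv_one_add_tan_sq hcQ]; simp
  rw [hd]
  simp only [Function.comp_apply, Pi.add_apply, Pi.sub_apply]
  rw [hP2, hQ2]
  set ρ := √(x t ^ 2 + y t ^ 2) with hρdef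
  have hρ2 : ρ ^ 2 = x t ^ 2 + y t ^ 2 := sq_sqrt (by positivity)
  have hunit : (x t / ρ) ^ 2 + (y t / ρ) ^ 2 = 1 := by
    rw [div_pow, div_pow, ← add_div, ← hρ2, div_self (pow_ne_zero 2 hnet)]
  have hk := kinetic_ge_of_unit (P := ω * tan (ω * s t))
    (Q := ω * tan (π / 2 - ε - ω * s t)) (a := τ * vx t) (b := τ * vy t) hunit
  have hx' : x t = x t / ρ * ρ := by field_simp
  generalize tan (ω * s t) = p at *
  generalize tan (π / 2 - ε - ω * s t) = q at *
  have e1 : ω * ((1 + p ^ 2) * (ω * (τ * ρ⁻¹))) * (ρ + x t) =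
      τ * (ω ^ 2 * (1 + p ^ 2) * (1 + x t / ρ)) := by field_simp
  have e2 : ω * ((1 + q ^ 2) * -(ω * (τ * ρ⁻¹))) * (ρ - x t) =
      -(τ * (ω ^ 2 * (1 + q ^ 2) * (1 - x t / ρ))) := by field_simp
  rw [e1, e2]
  have e3 : (τ * vx t) ^ 2 + (τ * vy t) ^ 2 = vx t ^ 2 + vy t ^ 2 := by
    linear_combination (vx t ^ 2 + vy t ^ 2) * hτ
  rw [e3] at hk
  refine le_trans (le_of_eq ?_) (sub_le_sub_right hk _)
  linear_combination (-(ω ^ 2 * (1 + p ^ 2) * (1 + x t / ρ)) -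
    ω ^ 2 * (1 + q ^ 2) * (1 - x t / ρ)) * hτ

/-- If a kinetic action `k` over total time `T` dominates `2 ω ^ 2 T` whenever `ω` times the
fictitious time `σ` is below `φ / 2`, then `k / 4 + σ` satisfies the Kepler bound. -/
theorem kepler_bound {k σ φ T : ℝ} (hT : 0 < T) (hφ : 0 ≤ φ) (hk : 0 ≤ k) (hσ : 0 ≤ σ)
    (h : 0 < φ → ∀ ω, 0 ≤ ω → ω * σ < φ / 2 → 2 * ω ^ 2 * T ≤ k) :
    3 / 8 * (16 : ℝ) ^ ((1 : ℝ) / 3) * (T * φ ^ 2) ^ ((1 : ℝ) / 3) ≤ k / 4 + σ := by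
  obtain rfl | hφ := hφ.eq_or_lt
  · rw [zero_pow two_ne_zero, mul_zero, zero_rpow (by norm_num)]
    linarith
  have hcube : ∀ a : ℝ, 0 ≤ a → (a ^ ((1 : ℝ) / 3)) ^ 3 = a := fun a ha => by
    rw [← rpow_natCast, ← rpow_mul ha]; norm_num
  set B := 1 / 8 * (16 : ℝ) ^ ((1 : ℝ) / 3) * (T * φ ^ 2) ^ ((1 : ℝ) / 3) with hB
  have hB0 : 0 ≤ B := by positivity
  have hB3 : 32 * B ^ 3 = T * φ ^ 2 := by
    rw [hB, mul_pow, mul_pow, hcube _ (by norm_num), hcube _ (by positivity)]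
    ring
  suffices 3 * B ≤ k / 4 + σ by rw [hB] at this; linarith
  by_contra! hlt
  set m := (k / 4 + (3 * B - σ)) / 2 with hm
  have hm0 : 0 < m := by linarith
  have hω2 : √(2 * m / T) ^ 2 = 2 * m / T := sq_sqrt (by positivity)
  have hσφ : √(2 * m / T) * σ < φ / 2 := by
    refine lt_of_pow_lt_pow_left₀ 2 (by positivity) ?_
    rw [mul_pow, hω2, div_mul_eq_mul_div, div_lt_iff₀ hT]
    obtain rfl | hσ := hσ.eq_or_lt
    · rw [zero_pow two_ne_zero, mul_zero]; positivity
    have h1 : m * σ ^ 2 < (3 * B - σ) * σ ^ 2 := by gcongr; linarith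
    have h2 : 0 ≤ (σ - 2 * B) ^ 2 * (σ + B) := by positivity
    nlinarith
  have := h hφ _ (sqrt_nonneg _) hσφ
  rw [hω2, mul_assoc, div_mul_cancel₀ _ hT.ne'] at this
  linarith

/-! ### Planar paths -/

/-- A planar path on `[0,1]` of class `H¹`, given by its coordinates and their derivatives. -/
structure PlanarPath where
  x : ℝ → ℝ
  y : ℝ → ℝ
  vx : ℝ → ℝ
  vy : ℝ → ℝ
  hx : IsPrimitive x vx
  hy : IsPrimitive y vy
  hE : IntervalIntegrable (fun t => vx t ^ 2 + vy t ^ 2) volume 0 1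

namespace PlanarPath

variable (γ γ' : PlanarPath)

/-- The distance to the origin. -/
def r (t : ℝ) : ℝ := √(γ.x t ^ 2 + γ.y t ^ 2)

/-- The component in the direction of angle `α`. -/
def proj (α t : ℝ) : ℝ := cos α * γ.x t + sin α * γ.y t

/-- The integral of the squared speed. -/
def energy : ℝ := ∫ t in (0 : ℝ)..1, (γ.vx t ^ 2 + γ.vy t ^ 2)

/-- The contribution of a pair of unit masses with relative position `γ` to the action of the
four-body problem. -/
def pairAction : ℝ≥0∞ :=
  ∫⁻ t in Icc (0 : ℝ) 1,
    (ENNReal.ofReal (1 / 8 * (γ.vx t ^ 2 + γ.vy t ^ 2)) + (ENNReal.ofReal (γ.r t))⁻¹)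

theorem r_nonneg (t : ℝ) : 0 ≤ γ.r t := sqrt_nonneg _

theorem energy_nonneg : 0 ≤ γ.energy :=
  intervalIntegral.integral_nonneg zero_le_one fun _ _ => by positivity

theorem sqrt_rotate (α t : ℝ) :
    √(γ.proj α t ^ 2 + (-sin α * γ.x t + cos α * γ.y t) ^ 2) = γ.r t := by
  rw [r, proj]
  congr 1
  linear_combination (γ.x t ^ 2 + γ.y t ^ 2) * sin_sq_add_cos_sq α

theorem neg_r_le_proj (α t : ℝ) : -γ.r t ≤ γ.proj α t := by
  refine neg_le_of_abs_le ?_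
  rw [← γ.sqrt_rotate α t]
  exact abs_le_sqrt (by nlinarith [sq_nonneg (-sin α * γ.x t + cos α * γ.y t)])

theorem continuousOn_r : ContinuousOn γ.r (Icc 0 1) :=
  ((γ.hx.continuousOn.pow 2).add (γ.hy.continuousOn.pow 2)).sqrt

theorem calibration_increment_le {s : ℝ → ℝ} {τ ω ε : ℝ} (α : ℝ)
    (hs : IsPrimitive s (fun t => τ * (γ.r t)⁻¹)) (hτ : τ ^ 2 = 1)
    (hne : ∀ᵐ t, t ∈ Ioo (0 : ℝ) 1 → γ.r t ≠ 0) (hε : 0 < ε)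
    (h0 : ∀ t ∈ Icc (0 : ℝ) 1, 0 ≤ ω * s t)
    (h1 : ∀ t ∈ Icc (0 : ℝ) 1, ω * s t + ε < π / 2) :
    τ * (calibration ω ε (s 1) (γ.r 1) (γ.proj α 1)
        - calibration ω ε (s 0) (γ.r 0) (γ.proj α 0)) ≤ γ.energy / 2 - 2 * ω ^ 2 := by
  have hspeed : ∀ t, (cos α * γ.vx t + sin α * γ.vy t) ^ 2
      + (-sin α * γ.vx t + cos α * γ.vy t) ^ 2 = γ.vx t ^ 2 + γ.vy t ^ 2 := fun t => by
    linear_combination (γ.vx t ^ 2 + γ.vy t ^ 2) * sin_sq_add_cos_sq α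
  have key := _root_.calibration_increment_le (x := γ.proj α)
    (y := fun t => -sin α * γ.x t + cos α * γ.y t) (τ := τ) (ω := ω) (ε := ε) (s := s)
    (γ.hx.linear_comb γ.hy (cos α) (sin α)) (γ.hx.linear_comb γ.hy (-sin α) (cos α))
    (by simpa only [sqrt_rotate] using hs) hτ (by simpa only [sqrt_rotate] using hne)
    (by simpa only [hspeed] using γ.hE) hε h0 h1
  simp only [sqrt_rotate, hspeed] at key
  rw [energy]
  linarith

/-- A pair path of finite action has integrable inverse distance, and its action is given by
Bochner integrals. -/
theorem integrable_of_pairAction_ne_top (h : γ.pairAction ≠ ∞) :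
    (∀ᵐ t, t ∈ Ioo (0 : ℝ) 1 → γ.r t ≠ 0) ∧
    IntervalIntegrable (fun t => (γ.r t)⁻¹) volume 0 1 ∧
    ENNReal.ofReal (γ.energy / 8 + ∫ t in (0 : ℝ)..1, (γ.r t)⁻¹) ≤ γ.pairAction := by
  have hle : (∫⁻ t in Icc (0 : ℝ) 1, ENNReal.ofReal (1 / 8 * (γ.vx t ^ 2 + γ.vy t ^ 2))) +
      ∫⁻ t in Icc (0 : ℝ) 1, (ENNReal.ofReal (γ.r t))⁻¹ ≤ γ.pairAction := le_lintegral_add _ _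
  have hfin : ∫⁻ t in Icc (0 : ℝ) 1, (ENNReal.ofReal (γ.r t))⁻¹ ≠ ∞ :=
    ne_top_of_le_ne_top h (le_add_self.trans hle)
  have hmeas : AEMeasurable γ.r (volume.restrict (Icc (0 : ℝ) 1)) :=
    γ.continuousOn_r.aemeasurable measurableSet_Icc
  have hne : ∀ᵐ t ∂volume.restrict (Icc (0 : ℝ) 1), 0 < γ.r t := by
    filter_upwards [ae_lt_top' hmeas.ennreal_ofReal.inv hfin] with t ht
    rwa [Pi.inv_apply, ENNReal.inv_lt_top, ENNReal.ofReal_pos] at ht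
  have hcongr : ∫⁻ t in Icc (0 : ℝ) 1, (ENNReal.ofReal (γ.r t))⁻¹ =
      ∫⁻ t in Icc (0 : ℝ) 1, ENNReal.ofReal (γ.r t)⁻¹ := by
    refine lintegral_congr_ae ?_
    filter_upwards [hne] with t ht
    rw [ENNReal.ofReal_inv_of_pos ht]
  have hnn : 0 ≤ᵐ[volume.restrict (Icc (0 : ℝ) 1)] fun t => (γ.r t)⁻¹ :=
    .of_forall fun t => inv_nonneg.2 (γ.r_nonneg t)
  have hint : IntegrableOn (fun t => (γ.r t)⁻¹) (Icc (0 : ℝ) 1) :=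
    (lintegral_ofReal_ne_top_iff_integrable hmeas.inv.aestronglyMeasurable hnn).1 (hcongr ▸ hfin)
  have hE : IntegrableOn (fun t => 1 / 8 * (γ.vx t ^ 2 + γ.vy t ^ 2)) (Icc (0 : ℝ) 1) :=
    ((intervalIntegrable_iff_integrableOn_Icc_of_le zero_le_one).1 γ.hE).const_mul _
  refine ⟨?_, (intervalIntegrable_iff_integrableOn_Icc_of_le zero_le_one).2 hint, ?_⟩
  · filter_upwards [(ae_restrict_iff' measurableSet_Icc).1 hne] with t ht htm
    exact (ht (Ioo_subset_Icc_self htm)).ne'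
  · refine le_trans (le_of_eq ?_) hle
    rw [hcongr, ← ofReal_integral_eq_lintegral_ofReal hint hnn,
      ← ofReal_integral_eq_lintegral_ofReal hE (.of_forall fun t => by positivity),
      ← ENNReal.ofReal_add (integral_nonneg fun t => by positivity)
        (integral_nonneg fun t => inv_nonneg.2 (γ.r_nonneg t)),
      energy, intervalIntegral.integral_of_le zero_le_one,
      intervalIntegral.integral_of_le zero_le_one, integral_Icc_eq_integral_Ioc,
      integral_Icc_eq_integral_Ioc, integral_const_mul]
    congr 2
    ring

theorem integral_inv_r_mem (h : IntervalIntegrable (fun t => (γ.r t)⁻¹) volume 0 1) {t : ℝ}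
    (ht : t ∈ Icc (0 : ℝ) 1) :
    ∫ u in (0 : ℝ)..t, (γ.r u)⁻¹ ∈ Icc 0 (∫ u in (0 : ℝ)..1, (γ.r u)⁻¹) :=
  ⟨intervalIntegral.integral_nonneg ht.1 fun u _ => inv_nonneg.2 (γ.r_nonneg u),
    intervalIntegral.integral_mono_interval le_rfl ht.1 ht.2
      (.of_forall fun u => inv_nonneg.2 (γ.r_nonneg u)) h⟩

/-- Action bound for a pair whose relative position starts in the direction `α` and ends with
angular distance at least `φ` from it, or in a collision. -/
theorem le_pairAction {α φ : ℝ} (hφ0 : 0 ≤ φ) (hφ : φ ≤ π) (h0 : γ.r 0 = γ.proj α 0)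
    (h1 : γ.proj α 1 ≤ γ.r 1 * cos φ) :
    ENNReal.ofReal (3 / 8 * (16 : ℝ) ^ ((1 : ℝ) / 3) * (φ ^ 2) ^ ((1 : ℝ) / 3)) ≤
      γ.pairAction := by
  by_cases htop : γ.pairAction = ∞
  · rw [htop]; exact le_top
  obtain ⟨hne, hint, hle⟩ := γ.integrable_of_pairAction_ne_top htop
  refine le_trans (ENNReal.ofReal_le_ofReal ?_) hle
  set σ := ∫ t in (0 : ℝ)..1, (γ.r t)⁻¹ with hσ
  have hmem := fun {t} => γ.integral_inv_r_mem hint (t := t)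
  have hσ0 : 0 ≤ σ := (hmem (t := 1) (by simp)).1
  have key := kepler_bound (k := γ.energy / 2) (σ := σ) (φ := φ) one_pos hφ0
    (by linarith [γ.energy_nonneg]) hσ0 fun hφpos ω hω hωσ => by
      have hinc := γ.calibration_increment_le (ω := ω) (ε := (φ / 2 - ω * σ) / 2) (τ := 1) α
        (IsPrimitive.of_integrable (by simpa using hint) 0) (by norm_num) hne (by linarith)
        (fun t ht => mul_nonneg hω (by simpa using (hmem ht).1))
        (fun t ht => by
          have := mul_le_mul_of_nonneg_left (hmem ht).2 hω
          simp only [zero_add, one_mul]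
          linarith)
      simp only [one_mul, zero_add, intervalIntegral.integral_same] at hinc
      rw [h0, calibration_start] at hinc
      have := calibration_nonneg hω hσ0 (ε := (φ / 2 - ω * σ) / 2) (by linarith) hφ (by linarith)
        (by linarith) (γ.r_nonneg 1) h1 (γ.neg_r_le_proj α 1)
      linarith
  rw [one_mul] at key
  linarith

/-- Action bound for two pairs that can be concatenated: after a rotation or reflection of the
second one, their relative positions at time `1` agree. The first one starts in direction `α`, and
the second one starts at angular distance at least `φ` from it, or in a collision. -/
theorem le_pairAction_add {α α' φ : ℝ} (hφ0 : 0 ≤ φ) (hφ : φ ≤ π) (h0 : γ.r 0 = γ.proj α 0)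
    (hr : γ.r 1 = γ'.r 1) (hp : γ.proj α 1 = γ'.proj α' 1)
    (h1 : γ'.proj α' 0 ≤ γ'.r 0 * cos φ) :
    ENNReal.ofReal (3 / 8 * (16 : ℝ) ^ ((1 : ℝ) / 3) * (2 * φ ^ 2) ^ ((1 : ℝ) / 3)) ≤
      γ.pairAction + γ'.pairAction := by
  by_cases htop : γ.pairAction = ∞
  · rw [htop, top_add]; exact le_top
  by_cases htop' : γ'.pairAction = ∞
  · rw [htop', add_top]; exact le_top
  obtain ⟨hne, hint, hle⟩ := γ.integrable_of_pairAction_ne_top htop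
  obtain ⟨hne', hint', hle'⟩ := γ'.integrable_of_pairAction_ne_top htop'
  set σ := ∫ t in (0 : ℝ)..1, (γ.r t)⁻¹ with hσ
  set σ' := ∫ t in (0 : ℝ)..1, (γ'.r t)⁻¹ with hσ'
  have hmem := fun {t} => γ.integral_inv_r_mem hint (t := t)
  have hmem' := fun {t} => γ'.integral_inv_r_mem hint' (t := t)
  have hσ0 : 0 ≤ σ := (hmem (t := 1) (by simp)).1
  have hσ0' : 0 ≤ σ' := (hmem' (t := 1) (by simp)).1
  have hE := γ.energy_nonneg
  have hE' := γ'.energy_nonneg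
  refine le_trans ?_ (add_le_add hle hle')
  rw [← ENNReal.ofReal_add (by positivity) (by positivity)]
  refine ENNReal.ofReal_le_ofReal ?_
  have key := kepler_bound (k := γ.energy / 2 + γ'.energy / 2) (σ := σ + σ') (φ := φ) two_pos hφ0
    (by positivity) (by positivity) fun hφpos ω hω hωσ => by
      have hωσ' : 0 ≤ ω * σ' := by positivity
      have hinc := γ.calibration_increment_le (ω := ω) (ε := (φ / 2 - ω * (σ + σ')) / 2)
        (τ := 1) α (IsPrimitive.of_integrable (by simpa using hint) 0) (by norm_num) hne
        (by linarith) (fun t ht => mul_nonneg hω (by simpa using (hmem ht).1))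
        (fun t ht => by
          have := mul_le_mul_of_nonneg_left (hmem ht).2 hω
          simp only [zero_add, one_mul]
          linarith)
      have hinc' := γ'.calibration_increment_le (ω := ω) (ε := (φ / 2 - ω * (σ + σ')) / 2)
        (τ := -1) α' (IsPrimitive.of_integrable (hint'.const_mul (-1)) (σ + σ')) (by norm_num)
        hne' (by linarith)
        (fun t ht => mul_nonneg hω (by
          rw [intervalIntegral.integral_const_mul]
          linarith [(hmem' ht).2]))
        (fun t ht => by
          have := mul_nonneg hω (hmem' ht).1
          rw [intervalIntegral.integral_const_mul]
          linarith)
      simp only [one_mul, zero_add, add_zero, intervalIntegral.integral_same] at hinc hinc'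
      have hs : σ + σ' + ∫ t in (0 : ℝ)..1, -1 * (γ'.r t)⁻¹ = σ := by
        rw [intervalIntegral.integral_const_mul]; linarith
      rw [hs, ← hr, ← hp] at hinc'
      rw [h0, calibration_start] at hinc
      have := calibration_nonneg hω (add_nonneg hσ0 hσ0') (ε := (φ / 2 - ω * (σ + σ')) / 2)
        (by linarith) hφ (by linarith) (by linarith) (γ'.r_nonneg 0) h1 (γ'.neg_r_le_proj α' 0)
      linarith
  linarith

end PlanarPath

/-! ### Decomposition of the action into pairs -/

theorem enorm2_sq (v : ℝ × ℝ) : enorm2 v ^ 2 = v.1 ^ 2 + v.2 ^ 2 := sq_sqrt (by positivity)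

namespace H1Path4

variable (p : H1Path4)

theorem isPrimitive_fst (i : Fin 4) :
    IsPrimitive (fun t => (p.q t i).1) (fun t => (p.v t i).1) where
  integrable := (intervalIntegrable_iff_integrableOn_Icc_of_le zero_le_one).2 (p.hvInt i).fst
  eq_add_integral t ht := by
    have hI : IntegrableOn (fun s => p.v s i) (Ioc 0 t) :=
      (p.hvInt i).mono_set (Ioc_subset_Icc_self.trans (Icc_subset_Icc_right ht.2))
    rw [p.hrep i t ht, Prod.fst_add, intervalIntegral.integral_of_le ht.1,
      intervalIntegral.integral_of_le ht.1, fst_integral hI]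

theorem isPrimitive_snd (i : Fin 4) :
    IsPrimitive (fun t => (p.q t i).2) (fun t => (p.v t i).2) where
  integrable := (intervalIntegrable_iff_integrableOn_Icc_of_le zero_le_one).2 (p.hvInt i).snd
  eq_add_integral t ht := by
    have hI : IntegrableOn (fun s => p.v s i) (Ioc 0 t) :=
      (p.hvInt i).mono_set (Ioc_subset_Icc_self.trans (Icc_subset_Icc_right ht.2))
    rw [p.hrep i t ht, Prod.snd_add, intervalIntegral.integral_of_le ht.1,
      intervalIntegral.integral_of_le ht.1, snd_integral hI]

/-- The path of `q j` relative to `q i`. -/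
def rel (i j : Fin 4) : PlanarPath where
  x t := (p.q t j).1 - (p.q t i).1
  y t := (p.q t j).2 - (p.q t i).2
  vx t := (p.v t j).1 - (p.v t i).1
  vy t := (p.v t j).2 - (p.v t i).2
  hx := by
    simpa [sub_eq_add_neg] using (p.isPrimitive_fst j).linear_comb (p.isPrimitive_fst i) 1 (-1)
  hy := by
    simpa [sub_eq_add_neg] using (p.isPrimitive_snd j).linear_comb (p.isPrimitive_snd i) 1 (-1)
  hE := by
    rw [intervalIntegrable_iff_integrableOn_Icc_of_le zero_le_one]
    have hm : ∀ k, AEStronglyMeasurable (fun t => p.v t k) (volume.restrict (Icc (0 : ℝ) 1)) :=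
      fun k => (p.hvInt k).aestronglyMeasurable
    refine (((p.hL2 j).add (p.hL2 i)).const_mul 2).mono'
      ((((hm j).fst.sub (hm i).fst).pow 2).add (((hm j).snd.sub (hm i).snd).pow 2))
      (.of_forall fun t => ?_)
    rw [norm_of_nonneg (by positivity)]
    simp only [Pi.add_apply, enorm2_sq]
    nlinarith [sq_nonneg ((p.v t j).1 + (p.v t i).1), sq_nonneg ((p.v t j).2 + (p.v t i).2)]

theorem enorm2_sub_eq_r (i j : Fin 4) (t : ℝ) :
    enorm2 (p.q t i - p.q t j) = (p.rel i j).r t := by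
  simp only [enorm2, PlanarPath.r, rel, Prod.fst_sub, Prod.snd_sub]
  congr 1
  ring

theorem sum_pairAction_le_action :
    ((p.rel 0 1).pairAction + (p.rel 2 3).pairAction) +
      ((p.rel 0 2).pairAction + (p.rel 1 3).pairAction) +
      (p.rel 0 3).pairAction + (p.rel 1 2).pairAction ≤ action p := by
  refine le_trans ?_ (lintegral_mono (f := fun t =>
    ((ENNReal.ofReal (1 / 8 * ((p.rel 0 1).vx t ^ 2 + (p.rel 0 1).vy t ^ 2)) +
        (ENNReal.ofReal ((p.rel 0 1).r t))⁻¹) +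
      (ENNReal.ofReal (1 / 8 * ((p.rel 2 3).vx t ^ 2 + (p.rel 2 3).vy t ^ 2)) +
        (ENNReal.ofReal ((p.rel 2 3).r t))⁻¹)) +
    ((ENNReal.ofReal (1 / 8 * ((p.rel 0 2).vx t ^ 2 + (p.rel 0 2).vy t ^ 2)) +
        (ENNReal.ofReal ((p.rel 0 2).r t))⁻¹) +
      (ENNReal.ofReal (1 / 8 * ((p.rel 1 3).vx t ^ 2 + (p.rel 1 3).vy t ^ 2)) +
        (ENNReal.ofReal ((p.rel 1 3).r t))⁻¹)) +
    (ENNReal.ofReal (1 / 8 * ((p.rel 0 3).vx t ^ 2 + (p.rel 0 3).vy t ^ 2)) +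
        (ENNReal.ofReal ((p.rel 0 3).r t))⁻¹) +
    (ENNReal.ofReal (1 / 8 * ((p.rel 1 2).vx t ^ 2 + (p.rel 1 2).vy t ^ 2)) +
        (ENNReal.ofReal ((p.rel 1 2).r t))⁻¹)) fun t => ?_)
  · refine le_trans ?_ (le_lintegral_add _ _)
    gcongr ?_ + _
    refine le_trans ?_ (le_lintegral_add _ _)
    gcongr ?_ + _
    exact (add_le_add (le_lintegral_add _ _) (le_lintegral_add _ _)).trans (le_lintegral_add _ _)
  · have hpot : (∑ i : Fin 4, ∑ j ∈ Finset.univ.filter (fun j => i < j),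
        (ENNReal.ofReal (enorm2 (p.q t i - p.q t j)))⁻¹) =
        (ENNReal.ofReal ((p.rel 0 1).r t))⁻¹ + (ENNReal.ofReal ((p.rel 0 2).r t))⁻¹ +
        (ENNReal.ofReal ((p.rel 0 3).r t))⁻¹ + (ENNReal.ofReal ((p.rel 1 2).r t))⁻¹ +
        (ENNReal.ofReal ((p.rel 1 3).r t))⁻¹ + (ENNReal.ofReal ((p.rel 2 3).r t))⁻¹ := by
      simp only [enorm2_sub_eq_r, Finset.sum_filter, Fin.sum_univ_four]
      simp [Fin.lt_def]
      ring
    have hkin : ENNReal.ofReal (1 / 8 * ((p.rel 0 1).vx t ^ 2 + (p.rel 0 1).vy t ^ 2)) +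
        ENNReal.ofReal (1 / 8 * ((p.rel 0 2).vx t ^ 2 + (p.rel 0 2).vy t ^ 2)) +
        ENNReal.ofReal (1 / 8 * ((p.rel 0 3).vx t ^ 2 + (p.rel 0 3).vy t ^ 2)) +
        ENNReal.ofReal (1 / 8 * ((p.rel 1 2).vx t ^ 2 + (p.rel 1 2).vy t ^ 2)) +
        ENNReal.ofReal (1 / 8 * ((p.rel 1 3).vx t ^ 2 + (p.rel 1 3).vy t ^ 2)) +
        ENNReal.ofReal (1 / 8 * ((p.rel 2 3).vx t ^ 2 + (p.rel 2 3).vy t ^ 2)) ≤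
        ENNReal.ofReal ((1 / 2) * ∑ i, enorm2 (p.v t i) ^ 2) := by
      repeat rw [← ENNReal.ofReal_add (by positivity) (by positivity)]
      refine ENNReal.ofReal_le_ofReal ?_
      simp only [Fin.sum_univ_four, enorm2_sq, rel]
      nlinarith [sq_nonneg ((p.v t 0).1 + (p.v t 1).1 + (p.v t 2).1 + (p.v t 3).1),
        sq_nonneg ((p.v t 0).2 + (p.v t 1).2 + (p.v t 2).2 + (p.v t 3).2)]
    rw [hpot]
    refine le_trans (le_of_eq ?_) (add_le_add_left hkin _)
    ring

end H1Path4

/-! ### Angles and estimates -/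

/-- Polar angles in the closed upper half plane increase as a point moves to the left. -/
theorem exists_polar_angles {X X' b : ℝ} (hb : 0 ≤ b) (hX : X' ≤ X) :
    ∃ β β' : ℝ, 0 ≤ β ∧ β ≤ β' ∧ β' ≤ π ∧
      X = √(X ^ 2 + b ^ 2) * cos β ∧ b = √(X ^ 2 + b ^ 2) * sin β ∧
      X' = √(X' ^ 2 + b ^ 2) * cos β' ∧ b = √(X' ^ 2 + b ^ 2) * sin β' := by
  have polar : ∀ Y : ℝ, Y = √(Y ^ 2 + b ^ 2) * cos (arccos (Y / √(Y ^ 2 + b ^ 2))) ∧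
      b = √(Y ^ 2 + b ^ 2) * sin (arccos (Y / √(Y ^ 2 + b ^ 2))) := by
    intro Y
    set ρ := √(Y ^ 2 + b ^ 2) with hρ
    have hρ2 : ρ ^ 2 = Y ^ 2 + b ^ 2 := sq_sqrt (by positivity)
    have habs : |Y| ≤ ρ := abs_le_sqrt (by nlinarith)
    obtain h0 | h0 := (sqrt_nonneg (Y ^ 2 + b ^ 2)).eq_or_lt
    · rw [← hρ] at h0
      rw [← h0] at hρ2 ⊢
      constructor <;> nlinarith [sq_nonneg Y, sq_nonneg b]
    rw [← hρ] at h0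
    have hle := abs_le.1 habs
    rw [cos_arccos (by rw [le_div_iff₀ h0]; linarith) (by rw [div_le_one h0]; exact hle.2),
      sin_arccos]
    refine ⟨by field_simp, ?_⟩
    have : 1 - (Y / ρ) ^ 2 = (b / ρ) ^ 2 := by
      field_simp
      linarith
    rw [this, sqrt_sq (by positivity)]
    field_simp
  have hmono : X' / √(X' ^ 2 + b ^ 2) ≤ X / √(X ^ 2 + b ^ 2) := by
    have hsq : ∀ Y, √(Y ^ 2 + b ^ 2) ^ 2 = Y ^ 2 + b ^ 2 := fun Y => sq_sqrt (by positivity)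
    obtain hX0 | hX0 := le_or_gt X 0
    · obtain rfl | hX0 := hX0.eq_or_lt
      · rw [zero_div]
        exact div_nonpos_of_nonpos_of_nonneg hX (sqrt_nonneg _)
      have h1 : 0 < √(X ^ 2 + b ^ 2) := by have := hX0.ne; positivity
      have h2 : 0 < √(X' ^ 2 + b ^ 2) := by have := (hX.trans_lt hX0).ne; positivity
      rw [div_le_div_iff₀ h2 h1, ← neg_le_neg_iff, ← neg_mul, ← neg_mul]
      refine (pow_le_pow_iff_left₀ (mul_nonneg (by linarith) h2.le)
        (mul_nonneg (by linarith) h1.le) two_ne_zero).1 ?_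
      rw [mul_pow, mul_pow, hsq, hsq]
      nlinarith [mul_nonneg (mul_nonneg (sub_nonneg.2 hX) (by linarith : 0 ≤ -(X + X')))
        (sq_nonneg b)]
    · obtain hX' | hX' := le_or_gt X' 0
      · exact (div_nonpos_of_nonpos_of_nonneg hX' (sqrt_nonneg _)).trans (by positivity)
      rw [div_le_div_iff₀ (by positivity) (by positivity)]
      refine (pow_le_pow_iff_left₀ (by positivity) (by positivity) two_ne_zero).1 ?_
      rw [mul_pow, mul_pow, hsq, hsq]
      nlinarith [mul_nonneg (mul_nonneg (sub_nonneg.2 hX) (by linarith : 0 ≤ X + X'))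
        (sq_nonneg b)]
  exact ⟨_, _, arccos_nonneg _, antitone_arccos hmono, arccos_le_pi _, (polar X).1, (polar X).2,
    (polar X').1, (polar X').2⟩

theorem cos_le_cos_of_le_two_pi_sub {φ x : ℝ} (h0 : 0 ≤ φ) (h1 : φ ≤ x) (h2 : x ≤ 2 * π - φ) :
    cos x ≤ cos φ := by
  obtain hx | hx := le_total x π
  · exact cos_le_cos_of_nonneg_of_le_pi h0 hx h1
  · rw [← cos_two_pi_sub x]
    exact cos_le_cos_of_nonneg_of_le_pi h0 (by linarith) (by linarith)

theorem sq_rpow_third {φ : ℝ} (h : 0 ≤ φ) : (φ ^ 2) ^ ((1 : ℝ) / 3) = φ ^ ((2 : ℝ) / 3) := by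
  rw [← rpow_natCast, ← rpow_mul h]
  norm_num

theorem two_mul_sq_rpow_third {φ : ℝ} (h : 0 ≤ φ) :
    (2 * φ ^ 2) ^ ((1 : ℝ) / 3) = 2 ^ ((1 : ℝ) / 3) * φ ^ ((2 : ℝ) / 3) := by
  rw [mul_rpow zero_le_two (sq_nonneg φ), sq_rpow_third h]

theorem two_mul_rpow_two_thirds {φ : ℝ} (h : 0 ≤ φ) :
    (2 * φ) ^ ((2 : ℝ) / 3) = ((2 : ℝ) ^ ((1 : ℝ) / 3)) ^ 2 * φ ^ ((2 : ℝ) / 3) := by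
  rw [mul_rpow zero_le_two h, ← rpow_natCast, ← rpow_mul zero_le_two]
  norm_num

theorem two_rpow_third_pow : ((2 : ℝ) ^ ((1 : ℝ) / 3)) ^ 3 = 2 := by
  rw [← rpow_natCast, ← rpow_mul zero_le_two]
  norm_num

theorem one_le_two_rpow_third : 1 ≤ (2 : ℝ) ^ ((1 : ℝ) / 3) :=
  one_le_rpow one_le_two (by norm_num)

theorem two_rpow_third_le : (2 : ℝ) ^ ((1 : ℝ) / 3) ≤ 3 / 2 := by
  refine (pow_le_pow_iff_left₀ (by positivity) (by norm_num) three_ne_zero).1 ?_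
  rw [two_rpow_third_pow]
  norm_num

/-- The combined bound for the four pairs joining the two halves of the configuration. -/
theorem two_mul_rpow_le_crossing {θ β β' : ℝ} (hθ : 0 < θ) (hβ : 0 ≤ β) (hββ' : β ≤ β') :
    2 * (2 * θ) ^ ((2 : ℝ) / 3) ≤
      2 ^ ((1 : ℝ) / 3) * (min (2 * θ + (β' - β)) (4 * θ)) ^ ((2 : ℝ) / 3)
        + (min (θ + β) (2 * θ)) ^ ((2 : ℝ) / 3) + |θ - β'| ^ ((2 : ℝ) / 3) := by
  have ht := one_le_two_rpow_third
  have ht3 := two_rpow_third_pow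
  set t := (2 : ℝ) ^ ((1 : ℝ) / 3)
  have hu : (0 : ℝ) ≤ 2 * θ := by positivity
  have hfour : (4 * θ) ^ ((2 : ℝ) / 3) = t ^ 2 * (2 * θ) ^ ((2 : ℝ) / 3) := by
    rw [← two_mul_rpow_two_thirds hu]
    ring_nf
  obtain hδ | hδ := le_total (4 * θ) (2 * θ + (β' - β))
  · rw [min_eq_right hδ, hfour]
    have hB : 0 ≤ (min (θ + β) (2 * θ)) ^ ((2 : ℝ) / 3) := by positivity
    have hC : 0 ≤ |θ - β'| ^ ((2 : ℝ) / 3) := by positivity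
    linear_combination hB + hC - (2 * θ) ^ ((2 : ℝ) / 3) * ht3
  rw [min_eq_left hδ]
  set l := (β' - β) / (2 * θ) with hl
  have hlδ : l * (2 * θ) = β' - β := div_mul_cancel₀ _ (by positivity)
  have hl0 : 0 ≤ l := div_nonneg (by linarith) hu
  have hl1 : 0 ≤ 1 - l := by
    rw [hl, sub_nonneg, div_le_one (by positivity)]
    linarith
  have hconc := (concaveOn_rpow (p := 2 / 3) (by norm_num) (by norm_num)).2
  have h1 := hconc (show 2 * θ ∈ Ici (0 : ℝ) from hu)
    (show 4 * θ ∈ Ici (0 : ℝ) by rw [mem_Ici]; positivity) hl1 hl0 (by ring)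
  have h2 := hconc (show 2 * θ ∈ Ici (0 : ℝ) from hu) (self_mem_Ici : (0 : ℝ) ∈ Ici 0) hl1 hl0
    (by ring)
  simp only [smul_eq_mul, hfour, mul_zero, add_zero,
    zero_rpow (by norm_num : (2 : ℝ) / 3 ≠ 0)] at h1 h2
  rw [show (1 - l) * (2 * θ) + l * (4 * θ) = 2 * θ + (β' - β) by linear_combination hlδ] at h1
  have h3 : (1 - l) * (2 * θ) ≤ min (θ + β) (2 * θ) + |θ - β'| := by
    have := le_abs_self (θ - β')
    obtain h | h := min_choice (θ + β) (2 * θ) <;> rw [h] <;> nlinarith [abs_nonneg (θ - β')]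
  have h4 := h2.trans ((rpow_le_rpow (mul_nonneg hl1 hu) h3 (by norm_num)).trans
    (rpow_add_le_add_rpow (by positivity) (by positivity) (by norm_num) (by norm_num)))
  have hU : 0 ≤ (2 * θ) ^ ((2 : ℝ) / 3) := by positivity
  linear_combination mul_le_mul_of_nonneg_left h1 (zero_le_one.trans ht) + h4 +
    mul_nonneg (mul_nonneg hl1 (sub_nonneg.2 ht)) hU - l * (2 * θ) ^ ((2 : ℝ) / 3) * ht3

/-- The combined bound when one of the relative positions of the crossing pairs ends in a
collision. -/
theorem rpow_le_of_crossing_collision {θ : ℝ} (hθ : 0 ≤ θ) (hθ' : θ ≤ π / 8) :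
    2 ^ ((1 : ℝ) / 3) * π ^ ((2 : ℝ) / 3) + 2 * (2 * θ) ^ ((2 : ℝ) / 3) ≤
      2 ^ ((1 : ℝ) / 3) * (π / 2) ^ ((2 : ℝ) / 3) +
        2 ^ ((1 : ℝ) / 3) * (2 * θ) ^ ((2 : ℝ) / 3) + π ^ ((2 : ℝ) / 3) := by
  have h1 := two_mul_rpow_two_thirds (φ := π / 2) (by positivity)
  have h2 := two_mul_rpow_two_thirds (φ := π / 4) (by positivity)
  rw [show 2 * (π / 2) = π by ring] at h1
  rw [show 2 * (π / 4) = π / 2 by ring] at h2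
  have h3 : (2 * θ) ^ ((2 : ℝ) / 3) ≤ (π / 4) ^ ((2 : ℝ) / 3) :=
    rpow_le_rpow (by positivity) (by linarith) (by norm_num)
  have ht := one_le_two_rpow_third
  have ht' := two_rpow_third_le
  have ht3 := two_rpow_third_pow
  set t := (2 : ℝ) ^ ((1 : ℝ) / 3)
  have hV : 0 ≤ (π / 4) ^ ((2 : ℝ) / 3) := by positivity
  rw [h1, h2]
  linear_combination mul_nonneg (by linarith : 0 ≤ 2 - t) (sub_nonneg.2 h3) +
    mul_nonneg (mul_nonneg (zero_le_one.trans ht) (by linarith : 0 ≤ 3 - 2 * t)) hV -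
    (1 + t - t ^ 2) * (π / 4) ^ ((2 : ℝ) / 3) * ht3

/-! ### Relative positions at the boundary -/

namespace PlanarPath

variable {γ γ' : PlanarPath} {θ u w t : ℝ}

theorem r_of_eq_rotV (h : (γ.x t, γ.y t) = rotV θ (u, w)) : γ.r t = √(u ^ 2 + w ^ 2) := by
  rw [rotV, Prod.mk.injEq] at h
  rw [r, h.1, h.2]
  congr 1
  linear_combination (u ^ 2 + w ^ 2) * sin_sq_add_cos_sq θ

theorem proj_of_eq_rotV (h : (γ.x t, γ.y t) = rotV θ (u, w)) (α : ℝ) :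
    γ.proj α t = u * cos (α - θ) + w * sin (α - θ) := by
  rw [rotV, Prod.mk.injEq] at h
  rw [proj, h.1, h.2, cos_sub, sin_sub]
  ring

/-- The bound for two pairs whose final relative positions are mirror images in the line of
angle `θ`. -/
theorem le_pairAction_add_of_reflect {α φ : ℝ} (h : (γ.x 1, γ.y 1) = rotV θ (u, w))
    (h' : (γ'.x 1, γ'.y 1) = rotV θ (u, -w)) (hφ0 : 0 ≤ φ) (hφ : φ ≤ π)
    (h0 : γ.r 0 = γ.proj α 0) (h1 : γ'.proj (2 * θ - α) 0 ≤ γ'.r 0 * cos φ) :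
    ENNReal.ofReal (3 / 8 * (16 : ℝ) ^ ((1 : ℝ) / 3) *
      (2 ^ ((1 : ℝ) / 3) * φ ^ ((2 : ℝ) / 3))) ≤ γ.pairAction + γ'.pairAction := by
  rw [← two_mul_sq_rpow_third hφ0]
  refine γ.le_pairAction_add γ' (α := α) (α' := 2 * θ - α) hφ0 hφ h0 ?_ ?_ h1
  · rw [r_of_eq_rotV h, r_of_eq_rotV h', neg_sq]
  · rw [proj_of_eq_rotV h, proj_of_eq_rotV h', show 2 * θ - α - θ = -(α - θ) by ring, cos_neg,
      sin_neg]
    ring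

/-- The bound for a pair whose final relative position lies on the ray of angle `θ`. -/
theorem le_pairAction_of_ray {α φ : ℝ} (hu : 0 ≤ u) (h : (γ.x 1, γ.y 1) = rotV θ (u, 0))
    (hφ0 : 0 ≤ φ) (hφ : φ ≤ π) (h0 : γ.r 0 = γ.proj α 0) (h1 : u = 0 ∨ cos (α - θ) ≤ cos φ) :
    ENNReal.ofReal (3 / 8 * (16 : ℝ) ^ ((1 : ℝ) / 3) * φ ^ ((2 : ℝ) / 3)) ≤ γ.pairAction := by
  rw [← sq_rpow_third hφ0]
  refine γ.le_pairAction hφ0 hφ h0 ?_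
  rw [r_of_eq_rotV h, proj_of_eq_rotV h, zero_pow two_ne_zero, add_zero, sqrt_sq hu]
  obtain rfl | h1 := h1
  · simp
  · nlinarith

end PlanarPath

theorem rotV_sub (θ : ℝ) (v w : ℝ × ℝ) : rotV θ v - rotV θ w = rotV θ (v - w) := by
  simp only [rotV, Prod.mk_sub_mk, Prod.fst_sub, Prod.snd_sub]
  ext <;> ring

theorem eq_zero_of_rotV_eq_zero {θ : ℝ} {v : ℝ × ℝ} (h : rotV θ v = 0) : v = 0 := by
  rw [rotV, Prod.mk_eq_zero] at h
  have := sin_sq_add_cos_sq θ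
  ext
  · simp only [Prod.fst_zero]
    linear_combination cos θ * h.1 + sin θ * h.2 - v.1 * this
  · simp only [Prod.snd_zero]
    linear_combination cos θ * h.2 - sin θ * h.1 - v.2 * this

namespace H1Path4

variable {p : H1Path4} {θ a₁ b₁ c₁ a₂ b₂ c₂ : ℝ}

theorem rel_end_eq
    (h1 : p.q 1 = fun i => rotV θ (![(-b₂, -a₂), (-c₂, a₂), (c₂, a₂), (b₂, -a₂)] i))
    (i j : Fin 4) : ((p.rel i j).x 1, (p.rel i j).y 1) =
      rotV θ ((![(-b₂, -a₂), (-c₂, a₂), (c₂, a₂), (b₂, -a₂)] : Fin 4 → ℝ × ℝ) j -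
        (![(-b₂, -a₂), (-c₂, a₂), (c₂, a₂), (b₂, -a₂)] : Fin 4 → ℝ × ℝ) i) := by
  rw [← rotV_sub, ← congrFun h1 i, ← congrFun h1 j]
  rfl

/-- The pairs `(0, 1)` and `(2, 3)` contribute at least the angle `π / 2` to the action. -/
theorem pi_div_two_le_diagonal (hθ : 0 ≤ θ) (hθ' : θ ≤ π / 2) (hb₁ : 0 ≤ b₁) (hc₁ : 0 ≤ c₁)
    (h0 : p.q 0 = ![(-a₁ - c₁, 0), (-a₁, 0), ((2 * a₁ + c₁) / 2, b₁), ((2 * a₁ + c₁) / 2, -b₁)])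
    (h1 : p.q 1 = fun i => rotV θ (![(-b₂, -a₂), (-c₂, a₂), (c₂, a₂), (b₂, -a₂)] i)) :
    ENNReal.ofReal (3 / 8 * (16 : ℝ) ^ ((1 : ℝ) / 3) *
      (2 ^ ((1 : ℝ) / 3) * (π / 2) ^ ((2 : ℝ) / 3))) ≤
      (p.rel 0 1).pairAction + (p.rel 2 3).pairAction := by
  refine PlanarPath.le_pairAction_add_of_reflect (θ := θ) (u := b₂ - c₂) (w := 2 * a₂) (α := 0)
    ?_ ?_ (by positivity) (by linarith [pi_pos]) ?_ ?_
  · rw [rel_end_eq h1]; congr 1; ext <;> simp <;> ring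
  · rw [rel_end_eq h1]; congr 1; (ext <;> simp); ring
  · simp [PlanarPath.r, PlanarPath.proj, rel, h0, sqrt_sq hc₁]
  · have := sin_nonneg_of_nonneg_of_le_pi (x := 2 * θ) (by linarith) (by linarith)
    simp [PlanarPath.proj, rel, h0]
    nlinarith

/-- A boundary collision of the pairs `(0, 1)` or `(2, 3)` raises their contribution to the
action. -/
theorem pi_le_diagonal_of_collision (hb₁ : 0 ≤ b₁) (hc₁ : 0 ≤ c₁)
    (h0 : p.q 0 = ![(-a₁ - c₁, 0), (-a₁, 0), ((2 * a₁ + c₁) / 2, b₁), ((2 * a₁ + c₁) / 2, -b₁)])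
    (h1 : p.q 1 = fun i => rotV θ (![(-b₂, -a₂), (-c₂, a₂), (c₂, a₂), (b₂, -a₂)] i))
    (hcol : b₁ = 0 ∨ c₁ = 0 ∨ a₂ = 0 ∧ b₂ = c₂) :
    ENNReal.ofReal (3 / 8 * (16 : ℝ) ^ ((1 : ℝ) / 3) *
      (2 ^ ((1 : ℝ) / 3) * π ^ ((2 : ℝ) / 3))) ≤
      (p.rel 0 1).pairAction + (p.rel 2 3).pairAction := by
  have e01 : ((p.rel 0 1).x 1, (p.rel 0 1).y 1) = rotV θ (b₂ - c₂, 2 * a₂) := by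
    rw [rel_end_eq h1]; congr 1; ext <;> simp <;> ring
  have e23 : ((p.rel 2 3).x 1, (p.rel 2 3).y 1) = rotV θ (b₂ - c₂, -(2 * a₂)) := by
    rw [rel_end_eq h1]; congr 1; (ext <;> simp); ring
  have s01 : (p.rel 0 1).r 0 = (p.rel 0 1).proj 0 0 := by
    simp [PlanarPath.r, PlanarPath.proj, rel, h0, sqrt_sq hc₁]
  have s23 : (p.rel 2 3).r 0 = (p.rel 2 3).proj (-(π / 2)) 0 := by
    simp only [PlanarPath.r, PlanarPath.proj, rel, h0]
    rw [cos_neg, sin_neg, cos_pi_div_two, sin_pi_div_two]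
    simp [sqrt_sq_eq_abs, abs_of_nonpos (by linarith : -b₁ - b₁ ≤ 0)]
  obtain rfl | rfl | ⟨rfl, rfl⟩ := hcol
  · refine PlanarPath.le_pairAction_add_of_reflect e01 e23 pi_pos.le le_rfl s01 ?_
    simp [PlanarPath.r, PlanarPath.proj, rel, h0]
  · rw [add_comm]
    refine PlanarPath.le_pairAction_add_of_reflect e23 (by rwa [neg_neg]) pi_pos.le le_rfl s23 ?_
    simp [PlanarPath.r, PlanarPath.proj, rel, h0]
  · rw [sub_self, mul_zero] at e01
    rw [sub_self, mul_zero, neg_zero] at e23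
    have k01 := PlanarPath.le_pairAction_of_ray le_rfl e01 pi_pos.le le_rfl s01 (.inl rfl)
    have k23 := PlanarPath.le_pairAction_of_ray le_rfl e23 pi_pos.le le_rfl s23 (.inl rfl)
    refine le_trans ?_ (add_le_add k01 k23)
    rw [← ENNReal.ofReal_add (by positivity) (by positivity)]
    refine ENNReal.ofReal_le_ofReal ?_
    have ht : (2 : ℝ) ^ ((1 : ℝ) / 3) ≤ 2 := two_rpow_third_le.trans (by norm_num)
    rw [← mul_add, ← two_mul]
    gcongr

/-- Angular bounds for the four pairs joining the two halves of the configuration. -/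
theorem exists_crossing_bounds (hb₁ : 0 ≤ b₁) (hc₁ : 0 ≤ c₁) (hb₂ : 0 ≤ b₂) (hc₂ : 0 ≤ c₂)
    (h0 : p.q 0 = ![(-a₁ - c₁, 0), (-a₁, 0), ((2 * a₁ + c₁) / 2, b₁), ((2 * a₁ + c₁) / 2, -b₁)])
    (h1 : p.q 1 = fun i => rotV θ (![(-b₂, -a₂), (-c₂, a₂), (c₂, a₂), (b₂, -a₂)] i)) :
    ∃ β β' : ℝ, 0 ≤ β ∧ β ≤ β' ∧ β' ≤ π ∧
      (∀ φ, 0 ≤ φ → φ ≤ π → cos (2 * θ + (β' - β)) ≤ cos φ →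
        ENNReal.ofReal (3 / 8 * (16 : ℝ) ^ ((1 : ℝ) / 3) *
          (2 ^ ((1 : ℝ) / 3) * φ ^ ((2 : ℝ) / 3))) ≤
          (p.rel 0 2).pairAction + (p.rel 1 3).pairAction) ∧
      (∀ φ, 0 ≤ φ → φ ≤ π → b₂ = 0 ∨ cos (θ + β) ≤ cos φ →
        ENNReal.ofReal (3 / 8 * (16 : ℝ) ^ ((1 : ℝ) / 3) * φ ^ ((2 : ℝ) / 3)) ≤
          (p.rel 0 3).pairAction) ∧
      (∀ φ, 0 ≤ φ → φ ≤ π → c₂ = 0 ∨ cos (θ - β') ≤ cos φ →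
        ENNReal.ofReal (3 / 8 * (16 : ℝ) ^ ((1 : ℝ) / 3) * φ ^ ((2 : ℝ) / 3)) ≤
          (p.rel 1 2).pairAction) := by
  obtain ⟨β, β', hβ, hββ', hβ', hX, hb, hX', hb'⟩ :=
    exists_polar_angles (X := (2 * a₁ + c₁) / 2 + (a₁ + c₁)) (X' := (2 * a₁ + c₁) / 2 + a₁) hb₁
      (by linarith)
  set ρ := √(((2 * a₁ + c₁) / 2 + (a₁ + c₁)) ^ 2 + b₁ ^ 2) with hρ
  set ρ' := √(((2 * a₁ + c₁) / 2 + a₁) ^ 2 + b₁ ^ 2) with hρ'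
  have hβ1 := sin_sq_add_cos_sq β
  have hβ1' := sin_sq_add_cos_sq β'
  have x02 : (p.rel 0 2).x 0 = ρ * cos β := by rw [← hX]; simp [rel, h0]; ring
  have y02 : (p.rel 0 2).y 0 = ρ * sin β := by rw [← hb]; simp [rel, h0]
  have x03 : (p.rel 0 3).x 0 = ρ * cos β := by rw [← hX]; simp [rel, h0]; ring
  have y03 : (p.rel 0 3).y 0 = -(ρ * sin β) := by rw [← hb]; simp [rel, h0]
  have x12 : (p.rel 1 2).x 0 = ρ' * cos β' := by rw [← hX']; simp [rel, h0]
  have y12 : (p.rel 1 2).y 0 = ρ' * sin β' := by rw [← hb']; simp [rel, h0]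
  have x13 : (p.rel 1 3).x 0 = ρ' * cos β' := by rw [← hX']; simp [rel, h0]
  have y13 : (p.rel 1 3).y 0 = -(ρ' * sin β') := by rw [← hb']; simp [rel, h0]
  have hr : ∀ s ψ : ℝ, 0 ≤ s → √((s * cos ψ) ^ 2 + (s * sin ψ) ^ 2) = s := fun s ψ hs => by
    rw [mul_pow, mul_pow, ← mul_add, cos_sq_add_sin_sq, mul_one, sqrt_sq hs]
  refine ⟨β, β', hβ, hββ', hβ', fun φ hφ0 hφ h => ?_, fun φ hφ0 hφ h => ?_, fun φ hφ0 hφ h => ?_⟩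
  · refine PlanarPath.le_pairAction_add_of_reflect (θ := θ) (u := b₂ + c₂) (w := 2 * a₂) (α := β)
      ?_ ?_ hφ0 hφ ?_ ?_
    · rw [rel_end_eq h1]; congr 1; ext <;> simp <;> ring
    · rw [rel_end_eq h1]; congr 1; (ext <;> simp); ring
    · rw [PlanarPath.r, PlanarPath.proj, x02, y02, hr _ _ (sqrt_nonneg _)]
      linear_combination -ρ * hβ1
    · rw [PlanarPath.r, PlanarPath.proj, x13, y13, neg_sq, hr _ _ (sqrt_nonneg _)]
      refine le_trans (le_of_eq ?_) (mul_le_mul_of_nonneg_left h (sqrt_nonneg _))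
      rw [show 2 * θ + (β' - β) = (2 * θ - β) + β' by ring, cos_add]
      ring
  · refine PlanarPath.le_pairAction_of_ray (θ := θ) (u := 2 * b₂) (α := -β) (by positivity) ?_
      hφ0 hφ ?_ (h.imp (by simp) fun h => ?_)
    · rw [rel_end_eq h1]; congr 1; (ext <;> simp); ring
    · rw [PlanarPath.r, PlanarPath.proj, x03, y03, neg_sq, hr _ _ (sqrt_nonneg _), cos_neg, sin_neg]
      linear_combination -ρ * hβ1
    · rwa [← cos_neg, show -(-β - θ) = θ + β by ring]
  · refine PlanarPath.le_pairAction_of_ray (θ := θ) (u := 2 * c₂) (α := β') (by positivity) ?_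
      hφ0 hφ ?_ (h.imp (by simp) fun h => ?_)
    · rw [rel_end_eq h1]; congr 1; (ext <;> simp); ring
    · rw [PlanarPath.r, PlanarPath.proj, x12, y12, hr _ _ (sqrt_nonneg _)]
      linear_combination -ρ' * hβ1'
    · rwa [← cos_neg, neg_sub]

/-- The four numbers in front of the Kepler constant add up to a lower bound for the action. -/
theorem le_action_of_le_pairAction {K x d e f g : ℝ} (hK : 0 ≤ K) (hx : x ≤ d + e + f + g)
    (hd : ENNReal.ofReal (K * d) ≤ (p.rel 0 1).pairAction + (p.rel 2 3).pairAction)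
    (he : ENNReal.ofReal (K * e) ≤ (p.rel 0 2).pairAction + (p.rel 1 3).pairAction)
    (hf : ENNReal.ofReal (K * f) ≤ (p.rel 0 3).pairAction)
    (hg : ENNReal.ofReal (K * g) ≤ (p.rel 1 2).pairAction) :
    ENNReal.ofReal (K * x) ≤ action p := by
  refine le_trans ?_ p.sum_pairAction_le_action
  refine le_trans ?_ (add_le_add (add_le_add (add_le_add hd he) hf) hg)
  refine (ENNReal.ofReal_le_ofReal (mul_le_mul_of_nonneg_left hx hK)).trans ?_
  rw [mul_add, mul_add, mul_add]
  refine ENNReal.ofReal_add_le.trans ?_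
  gcongr
  refine ENNReal.ofReal_add_le.trans ?_
  gcongr
  exact ENNReal.ofReal_add_le

/-- A boundary collision degenerates one of the boundary parameters. -/
theorem degenerate_of_collision (hb₂ : 0 ≤ b₂) (hc₂ : 0 ≤ c₂)
    (h0 : p.q 0 = ![(-a₁ - c₁, 0), (-a₁, 0), ((2 * a₁ + c₁) / 2, b₁), ((2 * a₁ + c₁) / 2, -b₁)])
    (h1 : p.q 1 = fun i => rotV θ (![(-b₂, -a₂), (-c₂, a₂), (c₂, a₂), (b₂, -a₂)] i))
    (hcol : ∃ t₀ ∈ ({0, 1} : Set ℝ), ∃ i j : Fin 4, i ≠ j ∧ p.q t₀ i = p.q t₀ j) :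
    (b₁ = 0 ∨ c₁ = 0 ∨ a₂ = 0 ∧ b₂ = c₂) ∨ b₂ = 0 ∨ c₂ = 0 := by
  obtain ⟨t₀, rfl | rfl, i, j, hij, h⟩ := hcol
  · left
    rw [h0] at h
    fin_cases i <;> fin_cases j <;> simp at hij h <;> grind
  · rw [← sub_eq_zero, h1, rotV_sub] at h
    have h := eq_zero_of_rotV_eq_zero h
    fin_cases i <;> fin_cases j <;> simp at hij h <;> grind

end H1Path4

/-- for `θ ∈ (0, π/10]`, an action minimizer over `P(Q_S, Q_{E₁})`
with a boundary collision has action at least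
`(3/8)·16^{1/3}·[(2π²)^{1/3} + 2(2θ)^{2/3}]`. -/
theorem statement13 (θ : ℝ) (hθ0 : 0 < θ) (hθ1 : θ ≤ π/10)
    (p : H1Path4) (hp : isMin (QE1set θ) p)
    (hcol : ∃ t₀ ∈ ({0, 1} : Set ℝ), ∃ i j : Fin 4, i ≠ j ∧ p.q t₀ i = p.q t₀ j) :
    ENNReal.ofReal ((3/8) * (16:ℝ) ^ ((1:ℝ)/3) *
      ((2 * π^2) ^ ((1:ℝ)/3) + 2 * (2*θ) ^ ((2:ℝ)/3))) ≤ action p := by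
  obtain ⟨⟨-, ⟨a₁, b₁, c₁, hb₁, hc₁, h0⟩, ⟨a₂, b₂, c₂, hb₂, hc₂, h1⟩⟩, -⟩ := hp
  obtain ⟨β, β', hβ, hββ', hβ', hA, hB, hC⟩ :=
    H1Path4.exists_crossing_bounds hb₁ hc₁ hb₂ hc₂ h0 h1
  have hK : 0 ≤ 3 / 8 * (16 : ℝ) ^ ((1 : ℝ) / 3) := by positivity
  have hA' := hA (min (2 * θ + (β' - β)) (4 * θ)) (le_min (by linarith) (by linarith))
    ((min_le_right _ _).trans (by linarith)) (cos_le_cos_of_le_two_pi_sub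
      (le_min (by linarith) (by linarith)) (min_le_left _ _)
      (by linarith [min_le_right (2 * θ + (β' - β)) (4 * θ)]))
  have hB' := hB (min (θ + β) (2 * θ)) (le_min (by linarith) (by linarith))
    ((min_le_right _ _).trans (by linarith)) (.inr (cos_le_cos_of_le_two_pi_sub
      (le_min (by linarith) (by linarith)) (min_le_left _ _)
      (by linarith [min_le_right (θ + β) (2 * θ)])))
  have hC' := hC |θ - β'| (abs_nonneg _) (abs_le.2 ⟨by linarith, by linarith⟩)
    (.inr (cos_abs _).ge)
  rw [two_mul_sq_rpow_third pi_pos.le]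
  obtain hdeg | hdeg := H1Path4.degenerate_of_collision hb₂ hc₂ h0 h1 hcol
  · refine H1Path4.le_action_of_le_pairAction hK ?_
      (H1Path4.pi_le_diagonal_of_collision hb₁ hc₁ h0 h1 hdeg) hA' hB' hC'
    linarith [two_mul_rpow_le_crossing hθ0 hβ hββ']
  · have hD := H1Path4.pi_div_two_le_diagonal hθ0.le (by linarith) hb₁ hc₁ h0 h1
    have hA'' := hA (2 * θ) (by linarith) (by linarith)
      (cos_le_cos_of_le_two_pi_sub (by linarith) (by linarith) (by linarith))
    have hnum := rpow_le_of_crossing_collision hθ0.le (by linarith : θ ≤ π / 8)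
    obtain hdeg | hdeg := hdeg
    · refine H1Path4.le_action_of_le_pairAction hK ?_ hD hA''
        (hB π pi_pos.le le_rfl (.inl hdeg)) hC'
      have : 0 ≤ |θ - β'| ^ ((2 : ℝ) / 3) := by positivity
      linarith
    · refine H1Path4.le_action_of_le_pairAction hK ?_ hD hA'' hB'
        (hC π pi_pos.le le_rfl (.inl hdeg))
      have : 0 ≤ (min (θ + β) (2 * θ)) ^ ((2 : ℝ) / 3) := by positivity
      linarith

end
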